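/- arXiv:1612.02671 — 3 statements merged into one kernel-verified Lean document; each statement's English description precedes it below -/
import Mathlib

section
/- Let 0 = p_0 < p_1 < … < p_m = n, let s : [n] → [m] be the monotone surjection with s(j) = r whenever p_{r−1} < j ≤ p_r, let d be a decoration of [m], set 0̃_m := s^{-1}(0̂_m), and let K be a field of characteristic 0. Let f_m, g_m : P^{d,ε}_m → K be related by f_m(Γ) = Σ_{Φ ∈ P^{d,ε}_m, Φ ≤ Γ} g_m(Φ) for all Γ ∈ P^{d,ε}_m, and let f_n, g_n : P^{d∘s,ε}_n → K be related by f_n(Γ) = Σ_{Φ ∈ P^{d∘s,ε}_n, Φ ≤ Γ} g_n(Φ) for all Γ ∈ P^{d∘s,ε}_n. Then the following are equivalent: (a) f_m(Γ) = f_n(s^{-1}(Γ)) for all Γ ∈ P^{d,ε}_m; (b) g_m(Γ) = Σ_{Φ ∈ P^{d∘s,ε}_n, Φ ∨ 0̃_m = s^{-1}(Γ)} g_n(Φ) for all Γ ∈ P^{d,ε}_m, where ∨ denotes the join in the lattice P^{d∘s,ε}_n. -/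
/-!
Common setup: ε-noncrossing partitions (Ebrahimi-Fard–Patras–Speicher).

A partition of `[n]` is encoded as a `Setoid (Fin n)` (blocks = equivalence
classes).  A decoration is a map `d : Fin n → I`, and `ε : I → I → Bool` is a
symmetric family of values in `{0,1}` (with `true` playing the role of `1`).
-/

namespace EpsNC

open scoped Classical

variable {I : Type*}

/-- The partition `σ(Γ)`: blocks are the images under `σ` of the blocks of `Γ`. -/
def permSetoid {n : ℕ} (σ : Equiv.Perm (Fin n)) (Γ : Setoid (Fin n)) : Setoid (Fin n) :=
  Setoid.comap (⇑σ⁻¹) Γ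

/-- The decoration `σ(d)`, `σ(d)(i) = d(σ⁻¹(i))`. -/
def permDec {n : ℕ} (σ : Equiv.Perm (Fin n)) (d : Fin n → I) : Fin n → I :=
  d ∘ ⇑σ⁻¹

/-- The adjacent transposition `(i, j)` with `j = i + 1` is an allowed move for the
`d`-decorated partition `Γ` if `ε_{d(i)d(j)} = 1` and either `d(i) ≠ d(j)`, or
`d(i) = d(j)` and `i`, `j` lie in different blocks of `Γ`. -/
def IsAllowedMove {n : ℕ} (ε : I → I → Bool) (d : Fin n → I) (Γ : Setoid (Fin n))
    (i j : Fin n) : Prop :=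
  (i : ℕ) + 1 = (j : ℕ) ∧ ε (d i) (d j) = true ∧ (d i ≠ d j ∨ ¬ Γ i j)

/-- `σ` is an allowed permutation of the `d`-decorated partition `Γ` if it is a product
`τ_{i_k} ⋯ τ_{i_1}` of adjacent transpositions, each being an allowed move for the
(decorated) partition obtained by applying the previous ones. -/
inductive AllowedPerm {n : ℕ} (ε : I → I → Bool) (d : Fin n → I) (Γ : Setoid (Fin n)) :
    Equiv.Perm (Fin n) → Prop
  | one : AllowedPerm ε d Γ 1
  | step {σ : Equiv.Perm (Fin n)} (i j : Fin n) :
      AllowedPerm ε d Γ σ →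
      IsAllowedMove ε (permDec σ d) (permSetoid σ Γ) i j →
      AllowedPerm ε d Γ (Equiv.swap i j * σ)

/-- Standardization of the restriction of a map on `Fin n` to a subset `S`,
via the unique order isomorphism `Fin S.card ≃o S`. -/
noncomputable def restrictFun {n : ℕ} {α : Type*} (f : Fin n → α) (S : Finset (Fin n)) :
    Fin S.card → α :=
  fun k => f (S.orderIsoOfFin rfl k).1

/-- Standardization of the restriction of a partition of `Fin n` to a subset `S`,
via the unique order isomorphism `Fin S.card ≃o S` (blocks are the nonempty
intersections of blocks with `S`, transported to `Fin S.card`). -/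
noncomputable def restrictSetoid {n : ℕ} (Γ : Setoid (Fin n)) (S : Finset (Fin n)) :
    Setoid (Fin S.card) :=
  Setoid.comap (fun k => (S.orderIsoOfFin rfl k).1) Γ

/-- The block of the partition `Γ` containing `b`. -/
noncomputable def blockOf {n : ℕ} (Γ : Setoid (Fin n)) (b : Fin n) : Finset (Fin n) :=
  Finset.univ.filter (fun x => Γ b x)

/-- A subset of `Fin n` is an interval of consecutive integers iff it is order-connected. -/
def IsIntervalBlock {n : ℕ} (S : Finset (Fin n)) : Prop :=
  ∀ ⦃x y z : Fin n⦄, x ∈ S → z ∈ S → x ≤ y → y ≤ z → y ∈ S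

/-- A `d`-decorated partition `Γ` of `[n]` is ε-noncrossing if it can be reduced to the
empty partition by a finite sequence of reductions: a reduction consists of an allowed
permutation `σ` of `Γ` together with a block of `σ(Γ)` which is an interval of
consecutive integers; it deletes that block and standardizes the result. -/
inductive IsEpsNC (ε : I → I → Bool) : {n : ℕ} → (Fin n → I) → Setoid (Fin n) → Prop
  | empty (d : Fin 0 → I) (Γ : Setoid (Fin 0)) : IsEpsNC ε d Γ
  | reduce {n : ℕ} {d : Fin n → I} {Γ : Setoid (Fin n)}
      (σ : Equiv.Perm (Fin n)) (b : Fin n)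
      (hσ : AllowedPerm ε d Γ σ)
      (hint : IsIntervalBlock (blockOf (permSetoid σ Γ) b))
      (hrec : IsEpsNC ε
        (restrictFun (permDec σ d) (blockOf (permSetoid σ Γ) b)ᶜ)
        (restrictSetoid (permSetoid σ Γ) (blockOf (permSetoid σ Γ) b)ᶜ)) :
      IsEpsNC ε d Γ

/-- A partition of `[n]` is noncrossing if there are no `i < j < k < l` with `i, k` in
one block and `j, l` in a different block. -/
def IsNoncrossing {n : ℕ} (Γ : Setoid (Fin n)) : Prop :=
  ∀ ⦃i j k l : Fin n⦄, i < j → j < k → k < l → Γ i k → Γ j l → Γ i j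

/-- The set of blocks of a partition, as finsets. -/
noncomputable def blocksSet {n : ℕ} (Γ : Setoid (Fin n)) : Set (Finset (Fin n)) :=
  {B | ∃ b : Fin n, B = blockOf Γ b}

/-- `k_ε^Γ(a₁, …, aₙ)`: the product over the blocks `Γ_j = {x₁ < … < x_m}` of `Γ` of the
cumulants `κ(a_{x₁}, …, a_{x_m})` (with the corresponding decorations). -/
noncomputable def cumPart {K A : Type*} [Field K] {n : ℕ}
    (κ : (m : ℕ) → (Fin m → I) → (Fin m → A) → K)
    (d : Fin n → I) (Γ : Setoid (Fin n)) (a : Fin n → A) : K :=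
  ∏ᶠ B ∈ blocksSet Γ, κ B.card (restrictFun d B) (restrictFun a B)

/-- `φ^Γ(a₁, …, aₙ)`: the product over the blocks `Γ_j = {x₁ < … < x_m}` of `Γ` of the
moments `φ(a_{x₁} ⋯ a_{x_m})`. -/
noncomputable def phiPart {K A : Type*} [Field K] [Ring A] [Algebra K A] {n : ℕ}
    (φ : A →ₗ[K] K) (Γ : Setoid (Fin n)) (a : Fin n → A) : K :=
  ∏ᶠ B ∈ blocksSet Γ, φ (List.ofFn (restrictFun a B)).prod

/-- The set of setoids on a finite type is finite (needed so that the sums over sets of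
ε-noncrossing partitions below, taken with `∑ᶠ`, are honest finite sums). -/
instance {n : ℕ} : Finite (Setoid (Fin n)) :=
  Finite.of_injective (fun Γ : Setoid (Fin n) => ⇑Γ)
    (fun _ _ h => Setoid.ext fun x y => iff_of_eq (congrFun (congrFun h x) y))

/-- `κ` is the family of ε-cumulants of the noncommutative probability space `(A, φ)`
with distinguished subalgebras `(As i)_{i ∈ I}`: for every `n`, every decoration
`d : Fin n → I` and every tuple `a` with `a j ∈ As (d j)`, the moment-cumulant relation
`φ(a₁ ⋯ aₙ) = Σ_{Γ ∈ P^{d,ε}_n} k_ε^Γ(a)` holds.  (This relation determines `κ`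
uniquely on such tuples.) -/
def CumulantFamily {K A : Type*} [Field K] [Ring A] [Algebra K A]
    (ε : I → I → Bool) (φ : A →ₗ[K] K) (As : I → Subalgebra K A)
    (κ : (m : ℕ) → (Fin m → I) → (Fin m → A) → K) : Prop :=
  ∀ (m : ℕ) (d : Fin m → I) (a : Fin m → A), (∀ j, a j ∈ As (d j)) →
    φ (List.ofFn a).prod = ∑ᶠ Γ ∈ {Γ : Setoid (Fin m) | IsEpsNC ε d Γ}, cumPart κ d Γ a

/-- The tuple `d = (d 1, …, d n)` lies in `I_n^ε`: whenever `d k = d l` for `k < l`,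
there is `k < p < l` with `d p ≠ d k` and `ε_{d(p)d(k)} = 0`. -/
def MemIeps {n : ℕ} (ε : I → I → Bool) (d : Fin n → I) : Prop :=
  ∀ k l : Fin n, k < l → d k = d l →
    ∃ p : Fin n, k < p ∧ p < l ∧ d p ≠ d k ∧ ε (d p) (d k) = false

/-- The subalgebras `(As i)_{i ∈ I}` are ε-independent in `(A, φ)`. -/
def EpsIndependent {K A : Type*} [Field K] [Ring A] [Algebra K A]
    (ε : I → I → Bool) (φ : A →ₗ[K] K) (As : I → Subalgebra K A) : Prop :=
  (∀ i j : I, i ≠ j → ε i j = true →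
    ∀ a ∈ As i, ∀ b ∈ As j, a * b = b * a) ∧
  (∀ (n : ℕ) (d : Fin n → I) (a : Fin n → A), MemIeps ε d →
    (∀ k, a k ∈ As (d k)) → (∀ k, φ (a k) = 0) → φ (List.ofFn a).prod = 0)

/-- The join of two partitions in the lattice `P^{d,ε}_n` of ε-noncrossing partitions:
the finest ε-noncrossing partition coarser than both (computed as the meet, in the full
partition lattice, of all ε-noncrossing upper bounds). -/
noncomputable def epsJoin {n : ℕ} (ε : I → I → Bool) (d : Fin n → I)
    (Φ Ψ : Setoid (Fin n)) : Setoid (Fin n) :=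
  sInf {Θ : Setoid (Fin n) | IsEpsNC ε d Θ ∧ Φ ≤ Θ ∧ Ψ ≤ Θ}

/-- A relation restricted to a subset. -/
def RelOn {α : Type*} (r : α → α → Prop) (T : Set α) (x y : α) : Prop :=
  x ∈ T ∧ y ∈ T ∧ r x y

/-- The block of `b` contains every point of an `r`-chain in `T` whose ends lie in the block. -/
def ChainConvex {α : Type*} (r : α → α → Prop) (Γ : Setoid α) (T : Set α) (b : α) : Prop :=
  ∀ ⦃x y z : α⦄, Γ b x → Γ b z → Relation.ReflTransGen (RelOn r T) x y →
    Relation.ReflTransGen (RelOn r T) y z → Γ b y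

/-- Every nonempty subset meets some block in a chain-convex subset. -/
def ChainNC {α : Type*} (r : α → α → Prop) (Γ : Setoid α) : Prop :=
  ∀ T : Set α, T.Nonempty → ∃ b ∈ T, ChainConvex r Γ T b

/-- The order relation between elements whose decorations do not commute. -/
def DecRel (ε : I → I → Bool) {n : ℕ} (d : Fin n → I) (x y : Fin n) : Prop :=
  x < y ∧ ε (d x) (d y) = false

theorem ChainNC.comap {α β : Type*} {r : α → α → Prop} {r' : β → β → Prop} {Γ : Setoid β}
    (h : ChainNC r' Γ) (φ : α → β) (hφ : ∀ x y, r x y → φ x = φ y ∨ r' (φ x) (φ y)) :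
    ChainNC r (Γ.comap φ) := by
  intro T hT
  obtain ⟨_, ⟨b, hb, rfl⟩, hc⟩ := h (φ '' T) (hT.image φ)
  have key : ∀ x y, Relation.ReflTransGen (RelOn r T) x y →
      Relation.ReflTransGen (RelOn r' (φ '' T)) (φ x) (φ y) := by
    intro x y hxy
    refine Relation.ReflTransGen.lift' φ ?_ _ _ hxy
    rintro a c ⟨ha, hc, hac⟩
    rcases hφ a c hac with h | h
    · rw [Function.onFun, h]
    · exact Relation.ReflTransGen.single ⟨⟨a, ha, rfl⟩, ⟨c, hc, rfl⟩, h⟩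
  exact ⟨b, hb, fun x y z hx hz hxy hyz => hc hx hz (key _ _ hxy) (key _ _ hyz)⟩

theorem chainNC_top {α : Type*} (r : α → α → Prop) : ChainNC r (⊤ : Setoid α) :=
  fun _ ⟨b, hb⟩ => ⟨b, hb, fun _ _ _ _ _ _ _ => trivial⟩

theorem ChainNC.inf {α : Type*} {r : α → α → Prop} {Γ Θ : Setoid α}
    (h : ChainNC r Γ) (h' : ChainNC r Θ) : ChainNC r (Γ ⊓ Θ) := by
  intro T hT
  obtain ⟨b, hb, hc⟩ := h T hT
  obtain ⟨c, ⟨hcT, hbc⟩, hcc⟩ := h' (T ∩ {x | Γ b x}) ⟨b, hb, Γ.refl b⟩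
  have key : ∀ x y z, Γ b x → Γ b z → Relation.ReflTransGen (RelOn r T) x y →
      Relation.ReflTransGen (RelOn r T) y z →
      Relation.ReflTransGen (RelOn r (T ∩ {x | Γ b x})) x y := by
    intro x y z hx hz hxy
    induction hxy with
    | refl => exact fun _ => .refl
    | @tail v w hxv hvw ih =>
      intro hwz
      have hvz := Relation.ReflTransGen.head hvw hwz
      exact (ih hvz).tail
        ⟨⟨hvw.1, hc hx hz hxv hvz⟩, ⟨hvw.2.1, hc hx hz (hxv.tail hvw) hwz⟩, hvw.2.2⟩
  refine ⟨c, hcT, fun x y z hx hz hxy hyz => ?_⟩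
  have hbx := Γ.trans hbc hx.1
  have hbz := Γ.trans hbc hz.1
  have hby : Γ b y := hc hbx hbz hxy hyz
  exact ⟨Γ.trans (Γ.symm hbc) hby,
    hcc hx.2 hz.2 (key x y z hbx hbz hxy hyz) (key y z z hby hbz hyz .refl)⟩

theorem ChainNC.sInf {α : Type*} {r : α → α → Prop} {S : Set (Setoid α)} (hS : S.Finite)
    (h : ∀ Γ ∈ S, ChainNC r Γ) : ChainNC r (sInf S) := by
  induction S, hS using Set.Finite.induction_on with
  | empty => rw [sInf_empty]; exact chainNC_top r
  | insert _ _ ih =>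
    rw [sInf_insert]
    exact (h _ (Set.mem_insert _ _)).inf (ih fun Γ hΓ => h Γ (Set.mem_insert_of_mem _ hΓ))

theorem swap_lt_swap_iff {n : ℕ} {i j x y : Fin n} (hij : (i : ℕ) + 1 = j)
    (h : ¬ (x = i ∧ y = j)) (h' : ¬ (x = j ∧ y = i)) :
    Equiv.swap i j x < Equiv.swap i j y ↔ x < y := by
  simp only [Equiv.swap_apply_def]
  split_ifs <;> simp only [Fin.lt_def, Fin.ext_iff] at * <;> omega

theorem AllowedPerm.lt_iff_lt {ε : I → I → Bool} (hsym : ∀ i j : I, ε i j = ε j i)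
    {n : ℕ} {d : Fin n → I} {Γ : Setoid (Fin n)} {σ : Equiv.Perm (Fin n)}
    (hσ : AllowedPerm ε d Γ σ) {x y : Fin n} (h : ε (d x) (d y) = false) :
    σ x < σ y ↔ x < y := by
  induction hσ with
  | one => rfl
  | @step σ i j _ hm ih =>
    rw [← ih, Equiv.Perm.mul_apply, Equiv.Perm.mul_apply]
    obtain ⟨hij, he, -⟩ := hm
    apply swap_lt_swap_iff hij
    · rintro ⟨rfl, rfl⟩
      simp [permDec, h] at he
    · rintro ⟨rfl, rfl⟩
      simp [permDec, hsym (d y), h] at he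

theorem le_of_chain {ε : I → I → Bool} {n : ℕ} {d : Fin n → I} {T : Set (Fin n)} {x y : Fin n}
    (h : Relation.ReflTransGen (RelOn (DecRel ε d) T) x y) : x ≤ y := by
  induction h with
  | refl => exact le_rfl
  | tail _ h ih => exact ih.trans h.2.2.1.le

theorem mem_blockOf {n : ℕ} {Γ : Setoid (Fin n)} {b x : Fin n} : x ∈ blockOf Γ b ↔ Γ b x := by
  simp [blockOf]

theorem permSetoid_apply {n : ℕ} (σ : Equiv.Perm (Fin n)) (Γ : Setoid (Fin n)) (x y : Fin n) :
    permSetoid σ Γ (σ x) (σ y) ↔ Γ x y := by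
  change Γ (σ⁻¹ (σ x)) (σ⁻¹ (σ y)) ↔ Γ x y
  simp

theorem chainNC_of_interval {ε : I → I → Bool} {n : ℕ} {d : Fin n → I} {Γ : Setoid (Fin n)}
    {b : Fin n} (hint : IsIntervalBlock (blockOf Γ b))
    (h : ChainNC (DecRel ε (restrictFun d (blockOf Γ b)ᶜ)) (restrictSetoid Γ (blockOf Γ b)ᶜ)) :
    ChainNC (DecRel ε d) Γ := by
  intro T hT
  by_cases hTb : ∃ c ∈ T, Γ b c
  · obtain ⟨c, hcT, hbc⟩ := hTb
    refine ⟨c, hcT, fun x y z hx hz hxy hyz => ?_⟩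
    have hby : Γ b y := mem_blockOf.1 <| hint (mem_blockOf.2 (Γ.trans hbc hx))
      (mem_blockOf.2 (Γ.trans hbc hz)) (le_of_chain hxy) (le_of_chain hyz)
    exact Γ.trans (Γ.symm hbc) hby
  · push Not at hTb
    set S := (blockOf Γ b)ᶜ with hS
    have hTS : ∀ x ∈ T, x ∈ S := fun x hx => by
      rw [hS, Finset.mem_compl, mem_blockOf]; exact hTb x hx
    obtain ⟨t₀, ht₀⟩ := hT
    let φ : Fin n → Fin S.card := fun x =>
      if hx : x ∈ S then (S.orderIsoOfFin rfl).symm ⟨x, hx⟩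
      else (S.orderIsoOfFin rfl).symm ⟨t₀, hTS _ ht₀⟩
    have hφ : ∀ x ∈ S, ((S.orderIsoOfFin rfl) (φ x)).1 = x := by
      intro x hx
      simp [φ, hx]
    have hlt : ∀ x ∈ S, ∀ y ∈ S, x < y → φ x < φ y := by
      intro x hx y hy hxy
      simpa [φ, hx, hy] using hxy
    have := h.comap (r := RelOn (DecRel ε d) T) φ (by
      rintro x y ⟨hx, hy, hxy, he⟩
      refine Or.inr ⟨hlt x (hTS x hx) y (hTS y hy) hxy, ?_⟩
      simp only [restrictFun]
      rw [hφ x (hTS x hx), hφ y (hTS y hy)]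
      exact he)
    obtain ⟨c, hcT, hc⟩ := this T ⟨t₀, ht₀⟩
    have hΓ : ∀ x ∈ T, ∀ y ∈ T, (restrictSetoid Γ S).comap φ x y ↔ Γ x y := by
      intro x hx y hy
      change Γ ((S.orderIsoOfFin rfl) (φ x)).1 ((S.orderIsoOfFin rfl) (φ y)).1 ↔ Γ x y
      rw [hφ x (hTS x hx), hφ y (hTS y hy)]
    refine ⟨c, hcT, fun x y z hx hz hxy hyz => ?_⟩
    have hmono : ∀ u v, RelOn (DecRel ε d) T u v → RelOn (RelOn (DecRel ε d) T) T u v :=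
      fun u v huv => ⟨huv.1, huv.2.1, huv⟩
    rcases hxy.cases_head with rfl | ⟨_, hxv, -⟩
    · exact hx
    rcases hyz.cases_tail with rfl | ⟨_, _, hwz⟩
    · exact hz
    rcases hyz.cases_head with rfl | ⟨_, hyw, -⟩
    · exact hz
    exact (hΓ c hcT y hyw.1).1 <| hc ((hΓ c hcT x hxv.1).2 hx) ((hΓ c hcT z hwz.2.1).2 hz)
      (Relation.ReflTransGen.mono hmono _ _ hxy) (Relation.ReflTransGen.mono hmono _ _ hyz)

theorem IsEpsNC.chainNC {ε : I → I → Bool} (hsym : ∀ i j : I, ε i j = ε j i)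
    {n : ℕ} {d : Fin n → I} {Γ : Setoid (Fin n)} (h : IsEpsNC ε d Γ) :
    ChainNC (DecRel ε d) Γ := by
  induction h with
  | empty d Γ => exact fun T ⟨x, _⟩ => x.elim0
  | @reduce n d Γ σ b hσ hint _ ih =>
    have h := (chainNC_of_interval hint ih).comap (r := DecRel ε d) σ (by
      rintro x y ⟨hxy, he⟩
      exact Or.inr ⟨(hσ.lt_iff_lt hsym he).2 hxy, by simpa [permDec] using he⟩)
    convert h using 1
    ext x y
    exact (permSetoid_apply σ Γ x y).symm

theorem exists_allowedPerm_monotone {ε : I → I → Bool} {n : ℕ} {d : Fin n → I}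
    {Γ : Setoid (Fin n)} (k : Fin n → ℕ)
    (hk : ∀ x y, x < y → k y < k x → ε (d x) (d y) = true ∧ (d x ≠ d y ∨ ¬ Γ x y)) :
    ∃ σ : Equiv.Perm (Fin n), AllowedPerm ε d Γ σ ∧ Monotone (k ∘ ⇑σ⁻¹) := by
  let R : Set (Equiv.Perm (Fin n)) :=
    {σ | AllowedPerm ε d Γ σ ∧ ∀ x y, x < y → σ y < σ x → k y < k x}
  obtain ⟨σ, ⟨hσ, hflip⟩, hmax⟩ := Set.exists_max_image R
    (fun σ => ∑ x, (σ x : ℕ) * k x) (Set.toFinite R)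
    ⟨1, .one, fun x y h h' => absurd h' (by simpa using h.le)⟩
  refine ⟨σ, hσ, ?_⟩
  obtain _ | n := n
  · exact fun x => x.elim0
  rw [Fin.monotone_iff_le_succ]
  intro l
  by_contra! hlt
  set i := l.castSucc with hi
  set j := l.succ with hj
  have hij : (i : ℕ) + 1 = j := by simp [hi, hj]
  have hijlt : i < j := by rw [Fin.lt_def]; omega
  obtain ⟨x, hx⟩ := σ.surjective i
  obtain ⟨y, hy⟩ := σ.surjective j
  have hx' : σ⁻¹ i = x := by rw [← hx]; simp
  have hy' : σ⁻¹ j = y := by rw [← hy]; simp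
  simp only [Function.comp_apply, hx', hy'] at hlt
  have hne : x ≠ y := by rintro rfl; exact lt_irrefl _ hlt
  have hxy : x < y := by
    rcases lt_or_gt_of_ne hne with h | h
    · exact h
    · exact absurd (hflip y x h (by rw [hx, hy]; exact hijlt)) hlt.asymm
  have hmem : Equiv.swap i j * σ ∈ R := by
    refine ⟨hσ.step i j ⟨hij, ?_, ?_⟩, ?_⟩
    · change ε (d (σ⁻¹ i)) (d (σ⁻¹ j)) = true
      rw [hx', hy']
      exact (hk x y hxy hlt).1
    · change d (σ⁻¹ i) ≠ d (σ⁻¹ j) ∨ ¬ Γ (σ⁻¹ i) (σ⁻¹ j)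
      rw [hx', hy']
      exact (hk x y hxy hlt).2
    · intro u v huv h
      rw [Equiv.Perm.mul_apply, Equiv.Perm.mul_apply] at h
      by_cases h1 : σ v = i ∧ σ u = j
      · rw [← hx, ← hy, σ.injective.eq_iff, σ.injective.eq_iff] at h1
        obtain ⟨rfl, rfl⟩ := h1
        exact absurd hxy huv.asymm
      by_cases h2 : σ v = j ∧ σ u = i
      · rw [← hx, ← hy, σ.injective.eq_iff, σ.injective.eq_iff] at h2
        obtain ⟨rfl, rfl⟩ := h2
        exact hlt
      exact hflip u v huv ((swap_lt_swap_iff hij h1 h2).1 h)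
  have hle := hmax _ hmem
  have hyx : y ∈ Finset.univ.erase x := by simp [hne.symm]
  rw [← Finset.add_sum_erase _ _ (Finset.mem_univ x), ← Finset.add_sum_erase _ _ hyx,
    ← Finset.add_sum_erase _ _ (Finset.mem_univ x), ← Finset.add_sum_erase _ _ hyx] at hle
  have hrest : ∑ z ∈ (Finset.univ.erase x).erase y, (((Equiv.swap i j * σ) z : Fin _) : ℕ) * k z
      = ∑ z ∈ (Finset.univ.erase x).erase y, (σ z : ℕ) * k z := by
    refine Finset.sum_congr rfl fun z hz => ?_
    simp only [Finset.mem_erase, Finset.mem_univ, and_true] at hz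
    rw [Equiv.Perm.mul_apply, Equiv.swap_apply_of_ne_of_ne]
    · rw [← hx]; exact fun h => hz.2 (σ.injective h)
    · rw [← hy]; exact fun h => hz.1 (σ.injective h)
  rw [hrest] at hle
  simp only [Equiv.Perm.mul_apply, hx, hy, Equiv.swap_apply_left, Equiv.swap_apply_right,
    ← hij] at hle
  nlinarith

theorem ChainNC.isEpsNC {ε : I → I → Bool} (hsym : ∀ i j : I, ε i j = ε j i)
    {n : ℕ} {d : Fin n → I} {Γ : Setoid (Fin n)} (h : ChainNC (DecRel ε d) Γ) :
    IsEpsNC ε d Γ := by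
  induction n using Nat.strong_induction_on with
  | _ n ihn =>
  obtain rfl | hn := Nat.eq_zero_or_pos n
  · exact .empty d Γ
  obtain ⟨b, -, hb⟩ := h Set.univ ⟨⟨0, hn⟩, trivial⟩
  let U : Fin n → Prop := fun x =>
    ∃ c, Γ b c ∧ Relation.ReflTransGen (RelOn (DecRel ε d) Set.univ) c x
  have hU : ∀ x y, U x → x < y → ε (d x) (d y) = false → U y := by
    rintro x y ⟨c, hc, hcx⟩ hxy he
    exact ⟨c, hc, hcx.tail ⟨trivial, trivial, hxy, he⟩⟩
  have hU' : ∀ x y, ¬ Γ b x → U x → x < y → d x = d y → U y := by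
    rintro x y hx ⟨c, hc, hcx⟩ hxy he
    rcases hcx.cases_tail with rfl | ⟨w, hcw, -, -, hwx, hε⟩
    · exact absurd hc hx
    · exact ⟨c, hc, hcw.tail ⟨trivial, trivial, hwx.trans hxy, he ▸ hε⟩⟩
  have hUself : ∀ x, Γ b x → U x := fun x hx => ⟨x, hx, .refl⟩
  let k : Fin n → ℕ := fun x => if Γ b x then 1 else if U x then 2 else 0
  have hk1 : ∀ x, k x = 1 ↔ Γ b x := by
    intro x
    simp only [k]
    split_ifs <;> simp_all
  obtain ⟨σ, hσ, hmono⟩ := exists_allowedPerm_monotone (ε := ε) (d := d) (Γ := Γ) k (by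
    intro x y hxy hlt
    by_cases hx : Γ b x
    · have hy : ¬ Γ b y := by intro hy; simp [k, hx, hy] at hlt
      have hUy : ¬ U y := by intro hUy; simp [k, hx, hy, hUy] at hlt
      refine ⟨?_, Or.inr fun hxy' => hy (Γ.trans hx hxy')⟩
      rw [← Bool.not_eq_false]
      exact fun he => hUy (hU x y (hUself x hx) hxy he)
    · have hUx : U x := by by_contra hUx; simp [k, hx, hUx] at hlt
      by_cases hy : Γ b y
      · refine ⟨?_, Or.inr fun hxy' => hx (Γ.trans hy (Γ.symm hxy'))⟩
        rw [← Bool.not_eq_false]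
        intro he
        obtain ⟨c, hc, hcx⟩ := hUx
        exact hx (hb hc hy hcx (.single ⟨trivial, trivial, hxy, he⟩))
      · have hUy : ¬ U y := by intro hUy; simp [k, hx, hy, hUy, hUx] at hlt
        refine ⟨?_, Or.inl fun he => hUy (hU' x y hx hUx hxy he)⟩
        rw [← Bool.not_eq_false]
        exact fun he => hUy (hU x y hUx hxy he))
  have hblock : ∀ x, x ∈ blockOf (permSetoid σ Γ) (σ b) ↔ k (σ⁻¹ x) = 1 := by
    intro x
    rw [mem_blockOf, hk1, ← permSetoid_apply σ Γ]
    simp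
  refine .reduce σ (σ b) hσ ?_ (ihn _ ?_ ?_)
  · intro x y z hx hz hxy hyz
    rw [hblock] at *
    have h1 := hmono hxy
    have h2 := hmono hyz
    simp only [Function.comp_apply] at h1 h2
    omega
  · refine (Finset.card_lt_univ_of_notMem (x := σ b) ?_).trans_eq (Fintype.card_fin n)
    rw [Finset.mem_compl, not_not, mem_blockOf]
  · refine h.comap (fun u => σ⁻¹ (Finset.orderIsoOfFin _ rfl u).1) ?_
    rintro u v ⟨huv, he⟩
    refine Or.inr ⟨?_, he⟩
    rw [← hσ.lt_iff_lt hsym he]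
    simpa using huv

theorem isEpsNC_iff_chainNC {ε : I → I → Bool} (hsym : ∀ i j : I, ε i j = ε j i)
    {n : ℕ} {d : Fin n → I} {Γ : Setoid (Fin n)} :
    IsEpsNC ε d Γ ↔ ChainNC (DecRel ε d) Γ :=
  ⟨fun h => h.chainNC hsym, fun h => h.isEpsNC hsym⟩

theorem IsEpsNC.comap_monotone {ε : I → I → Bool} (hsym : ∀ i j : I, ε i j = ε j i)
    {n m : ℕ} {s : Fin n → Fin m} (hs : Monotone s) {d : Fin m → I} {Γ : Setoid (Fin m)}
    (h : IsEpsNC ε d Γ) : IsEpsNC ε (d ∘ s) (Γ.comap s) := by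
  rw [isEpsNC_iff_chainNC hsym] at *
  refine h.comap s ?_
  rintro x y ⟨hxy, he⟩
  exact (hs hxy.le).eq_or_lt.imp_right fun hlt => ⟨hlt, he⟩

theorem isEpsNC_epsJoin {ε : I → I → Bool} (hsym : ∀ i j : I, ε i j = ε j i)
    {n : ℕ} (d : Fin n → I) (Φ Ψ : Setoid (Fin n)) : IsEpsNC ε d (epsJoin ε d Φ Ψ) :=
  (ChainNC.sInf (Set.toFinite _) fun _ hΘ => hΘ.1.chainNC hsym).isEpsNC hsym

theorem le_epsJoin_left (ε : I → I → Bool) {n : ℕ} (d : Fin n → I) (Φ Ψ : Setoid (Fin n)) :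
    Φ ≤ epsJoin ε d Φ Ψ :=
  le_sInf fun _ h => h.2.1

theorem le_epsJoin_right (ε : I → I → Bool) {n : ℕ} (d : Fin n → I) (Φ Ψ : Setoid (Fin n)) :
    Ψ ≤ epsJoin ε d Φ Ψ :=
  le_sInf fun _ h => h.2.2

/-- Coarsenings of the kernel of `s` are pullbacks along `s`. -/
theorem exists_comap_eq_of_ker_le {ε : I → I → Bool} (hsym : ∀ i j : I, ε i j = ε j i)
    {n m : ℕ} {s : Fin n → Fin m} (hmono : Monotone s) (hsurj : Function.Surjective s)
    {d : Fin m → I} {J : Setoid (Fin n)} (hJ : IsEpsNC ε (d ∘ s) J) (hker : Setoid.ker s ≤ J) :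
    ∃ Δ : Setoid (Fin m), IsEpsNC ε d Δ ∧ Δ.comap s = J := by
  obtain ⟨t, ht⟩ := hsurj.hasRightInverse
  have htm : Monotone t := by
    intro a c hac
    by_contra! hlt
    have h := hmono hlt.le
    rw [ht, ht] at h
    obtain rfl := le_antisymm hac h
    exact lt_irrefl _ hlt
  refine ⟨J.comap t, ?_, ?_⟩
  · have h := hJ.comap_monotone hsym htm
    rwa [Function.comp_assoc, ht.comp_eq_id, Function.comp_id] at h
  · have hst : ∀ x, J (t (s x)) x := fun x => hker (ht (s x))
    ext x y
    simp only [Setoid.comap_rel]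
    exact ⟨fun h => J.trans (J.symm (hst x)) (J.trans h (hst y)),
      fun h => J.trans (hst x) (J.trans h (J.symm (hst y)))⟩

theorem comap_le_comap_iff {α β : Type*} {s : α → β} (hsurj : Function.Surjective s)
    {Γ Δ : Setoid β} : Δ.comap s ≤ Γ.comap s ↔ Δ ≤ Γ := by
  constructor
  · intro h x y hxy
    obtain ⟨x, rfl⟩ := hsurj x
    obtain ⟨y, rfl⟩ := hsurj y
    exact h hxy
  · exact fun h x y hxy => h hxy

theorem comap_injective {α β : Type*} {s : α → β} (hsurj : Function.Surjective s) :
    Function.Injective (Setoid.comap s) := fun _ _ h =>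
  le_antisymm ((comap_le_comap_iff hsurj).1 h.le) ((comap_le_comap_iff hsurj).1 h.ge)

/-- Grouping the lower set of `s⁻¹(Γ)` by the join with the kernel of `s`. -/
theorem sum_le_comap_eq {K : Type*} [AddCommMonoid K] {ε : I → I → Bool}
    (hsym : ∀ i j : I, ε i j = ε j i)
    {n m : ℕ} {s : Fin n → Fin m} (hmono : Monotone s) (hsurj : Function.Surjective s)
    {d : Fin m → I} (g : Setoid (Fin n) → K) {Γ : Setoid (Fin m)} (hΓ : IsEpsNC ε d Γ) :
    ∑ᶠ Φ ∈ {Φ : Setoid (Fin n) | IsEpsNC ε (d ∘ s) Φ ∧ Φ ≤ Γ.comap s}, g Φ =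
      ∑ᶠ Δ ∈ {Δ : Setoid (Fin m) | IsEpsNC ε d Δ ∧ Δ ≤ Γ},
        ∑ᶠ Φ ∈ {Φ : Setoid (Fin n) | IsEpsNC ε (d ∘ s) Φ ∧
          epsJoin ε (d ∘ s) Φ (Setoid.ker s) = Δ.comap s}, g Φ := by
  rw [← finsum_mem_biUnion _ (Set.toFinite _) fun _ _ => Set.toFinite _]
  · congr! 3 with Φ
    simp only [Set.mem_ofPred_eq, Set.mem_iUnion, exists_prop]
    constructor
    · rintro ⟨hΦ, hle⟩
      obtain ⟨Δ, hΔ, hΔJ⟩ := exists_comap_eq_of_ker_le hsym hmono hsurj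
        (isEpsNC_epsJoin hsym (d ∘ s) Φ (Setoid.ker s)) (le_epsJoin_right ε _ _ _)
      refine ⟨Δ, ⟨hΔ, ?_⟩, hΦ, hΔJ.symm⟩
      rw [← comap_le_comap_iff hsurj, hΔJ]
      refine sInf_le ⟨hΓ.comap_monotone hsym hmono, hle, fun x y hxy => ?_⟩
      rw [Setoid.comap_rel, Setoid.ker_def.1 hxy]
    · rintro ⟨Δ, ⟨_, hΔΓ⟩, hΦ, hJ⟩
      exact ⟨hΦ, (le_epsJoin_left ε _ _ _).trans
        (hJ.trans_le ((comap_le_comap_iff hsurj).2 hΔΓ))⟩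
  · intro Δ _ Δ' _ hne
    rw [Function.onFun, Set.disjoint_left]
    rintro Φ ⟨_, h⟩ ⟨_, h'⟩
    exact hne (comap_injective hsurj (h.symm.trans h'))

/-- A function on a finite poset is determined by its sums over principal lower sets. -/
theorem eq_of_sum_le_eq {P K : Type*} [PartialOrder P] [Finite P] [AddCommGroup K]
    {p : P → Prop} {g h : P → K}
    (hgh : ∀ a, p a → ∑ᶠ x ∈ {x | p x ∧ x ≤ a}, g x = ∑ᶠ x ∈ {x | p x ∧ x ≤ a}, h x)
    (a : P) (ha : p a) : g a = h a := by
  induction a using WellFoundedLT.induction with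
  | ind a ih =>
  have hset : {x | p x ∧ x ≤ a} = insert a {x | p x ∧ x < a} := by
    ext x
    simp only [Set.mem_ofPred_eq, Set.mem_insert_iff, le_iff_eq_or_lt]
    constructor
    · rintro ⟨hx, rfl | hlt⟩
      exacts [Or.inl rfl, Or.inr ⟨hx, hlt⟩]
    · rintro (rfl | ⟨hx, hlt⟩)
      exacts [⟨ha, Or.inl rfl⟩, ⟨hx, Or.inr hlt⟩]
  have hsum := hgh a ha
  rw [hset, finsum_mem_insert _ (by simp) (Set.toFinite _),
    finsum_mem_insert _ (by simp) (Set.toFinite _),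
    finsum_mem_congr (s := {x | p x ∧ x < a}) rfl fun x hx => ih x hx.2 hx.1] at hsum
  exact add_right_cancel hsum

/-- Let `s : [n] → [m]` be a monotone surjection (equivalently, the map
determined by `0 = p₀ < p₁ < … < p_m = n`), `d` a decoration of `[m]`, and
`0̃_m = s⁻¹(0̂_m) = Setoid.ker s`.  Let `f_m, g_m` on `P^{d,ε}_m` and `f_n, g_n` on
`P^{d∘s,ε}_n` be related by summation over the order ideals.  Then
`f_m(Γ) = f_n(s⁻¹(Γ))` for all `Γ ∈ P^{d,ε}_m` iff
`g_m(Γ) = Σ_{Φ ∈ P^{d∘s,ε}_n, Φ ∨ 0̃_m = s⁻¹(Γ)} g_n(Φ)` for all `Γ ∈ P^{d,ε}_m`,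
where `∨` is the join in the lattice `P^{d∘s,ε}_n`. -/
theorem moebius_transfer {I K : Type*} [Field K] [CharZero K] (ε : I → I → Bool)
    (hsym : ∀ i j : I, ε i j = ε j i)
    {n m : ℕ} (s : Fin n → Fin m) (hmono : Monotone s) (hsurj : Function.Surjective s)
    (d : Fin m → I)
    (fm gm : Setoid (Fin m) → K) (fn gn : Setoid (Fin n) → K)
    (hfm : ∀ Γ : Setoid (Fin m), IsEpsNC ε d Γ →
      fm Γ = ∑ᶠ Φ ∈ {Φ : Setoid (Fin m) | IsEpsNC ε d Φ ∧ Φ ≤ Γ}, gm Φ)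
    (hfn : ∀ Γ : Setoid (Fin n), IsEpsNC ε (d ∘ s) Γ →
      fn Γ = ∑ᶠ Φ ∈ {Φ : Setoid (Fin n) | IsEpsNC ε (d ∘ s) Φ ∧ Φ ≤ Γ}, gn Φ) :
    (∀ Γ : Setoid (Fin m), IsEpsNC ε d Γ → fm Γ = fn (Setoid.comap s Γ)) ↔
    (∀ Γ : Setoid (Fin m), IsEpsNC ε d Γ →
      gm Γ = ∑ᶠ Φ ∈ {Φ : Setoid (Fin n) | IsEpsNC ε (d ∘ s) Φ ∧
        epsJoin ε (d ∘ s) Φ (Setoid.ker s) = Setoid.comap s Γ}, gn Φ) := by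
  have key : ∀ Γ : Setoid (Fin m), IsEpsNC ε d Γ → fn (Setoid.comap s Γ) = _ := fun Γ hΓ =>
    (hfn _ (hΓ.comap_monotone hsym hmono)).trans (sum_le_comap_eq hsym hmono hsurj gn hΓ)
  constructor
  · intro h
    refine eq_of_sum_le_eq fun Γ hΓ => ?_
    rw [← hfm Γ hΓ, h Γ hΓ, key Γ hΓ]
  · intro h Γ hΓ
    rw [hfm Γ hΓ, key Γ hΓ]
    exact finsum_mem_congr rfl fun Δ hΔ => h Δ hΔ.1

end EpsNC
end

section
/- Assume that the subalgebras A_i and A_j commute elementwise whenever i ≠ j and ε_{ij} = 1. Let Γ be a d-decorated partition of [n], let a_j ∈ A_{d(j)} for all j, let τ_i be an allowed move for Γ, and set Γ' := τ_i(Γ). Then φ^Γ(a_1, …, a_n) = φ^{Γ'}(a_1, …, a_{i−1}, a_{i+1}, a_i, a_{i+2}, …, a_n) and k_ε^Γ(a_1, …, a_n) = k_ε^{Γ'}(a_1, …, a_{i−1}, a_{i+1}, a_i, a_{i+2}, …, a_n). -/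
/-!
Common setup: ε-noncrossing partitions (Ebrahimi-Fard–Patras–Speicher).

A partition of `[n]` is encoded as a `Setoid (Fin n)` (blocks = equivalence
classes).  A decoration is a map `d : Fin n → I`, and `ε : I → I → Bool` is a
symmetric family of values in `{0,1}` (with `true` playing the role of `1`).
-/

namespace EpsNC

open scoped Classical

variable {I : Type*}

lemma comap_swap_comap_swap {n : ℕ} (Γ : Setoid (Fin n)) (i j : Fin n) :
    Setoid.comap (⇑(Equiv.swap i j)) (Setoid.comap (⇑(Equiv.swap i j)) Γ) = Γ := by
  ext x y
  simp [Setoid.comap_rel]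

lemma permSetoid_mul {n : ℕ} (σ τ : Equiv.Perm (Fin n)) (Γ : Setoid (Fin n)) :
    permSetoid (σ * τ) Γ = permSetoid σ (permSetoid τ Γ) :=
  rfl

lemma permDec_mul {n : ℕ} (σ τ : Equiv.Perm (Fin n)) (d : Fin n → I) :
    permDec (σ * τ) d = permDec σ (permDec τ d) :=
  rfl

lemma AllowedPerm.mul {n : ℕ} {ε : I → I → Bool} {d : Fin n → I} {Γ : Setoid (Fin n)}
    {σ τ : Equiv.Perm (Fin n)} (hτ : AllowedPerm ε d Γ τ)
    (hσ : AllowedPerm ε (permDec τ d) (permSetoid τ Γ) σ) : AllowedPerm ε d Γ (σ * τ) := by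
  induction hσ with
  | one => simpa using hτ
  | step i j _ hm ih =>
    rw [mul_assoc]
    refine AllowedPerm.step i j ih ?_
    rwa [permDec_mul, permSetoid_mul]

/-- ε-noncrossingness can be tested after an allowed permutation. -/
lemma IsEpsNC.of_allowedPerm {n : ℕ} {ε : I → I → Bool} {d : Fin n → I} {Γ : Setoid (Fin n)}
    {τ : Equiv.Perm (Fin n)} (hτ : AllowedPerm ε d Γ τ)
    (h : IsEpsNC ε (permDec τ d) (permSetoid τ Γ)) : IsEpsNC ε d Γ := by
  generalize hd : permDec τ d = d' at h
  generalize hΓ : permSetoid τ Γ = Γ' at h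
  cases h with
  | empty => exact IsEpsNC.empty d Γ
  | reduce σ b hσ hint hrec =>
    subst hd hΓ
    rw [← permSetoid_mul] at hint hrec
    rw [← permDec_mul] at hrec
    exact IsEpsNC.reduce (σ * τ) b (hτ.mul hσ) hint hrec

lemma IsEpsNC.of_swap {n : ℕ} {ε : I → I → Bool} {d : Fin n → I} {Γ : Setoid (Fin n)}
    {i j : Fin n} (hm : IsAllowedMove ε d Γ i j)
    (h : IsEpsNC ε (d ∘ ⇑(Equiv.swap i j)) (Setoid.comap (⇑(Equiv.swap i j)) Γ)) :
    IsEpsNC ε d Γ := by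
  refine IsEpsNC.of_allowedPerm (τ := Equiv.swap i j) ?_ ?_
  · have := AllowedPerm.step (ε := ε) (d := d) (Γ := Γ) i j AllowedPerm.one
      (by simpa [permDec, permSetoid] using hm)
    simpa using this
  · simpa [permDec, permSetoid] using h

lemma isEpsNC_of_eq_zero {n : ℕ} (hn : n = 0) (ε : I → I → Bool) (d : Fin n → I)
    (Γ : Setoid (Fin n)) : IsEpsNC ε d Γ := by
  subst hn
  exact IsEpsNC.empty d Γ

lemma blockOf_top {n : ℕ} (b : Fin n) : blockOf (⊤ : Setoid (Fin n)) b = Finset.univ := by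
  ext x
  simp [blockOf, Setoid.top_def]

lemma isEpsNC_top {n : ℕ} (ε : I → I → Bool) (d : Fin n → I) : IsEpsNC ε d ⊤ := by
  rcases Nat.eq_zero_or_pos n with rfl | hn
  · exact IsEpsNC.empty d ⊤
  · have hB : blockOf (permSetoid 1 (⊤ : Setoid (Fin n))) ⟨0, hn⟩ = Finset.univ :=
      blockOf_top _
    refine IsEpsNC.reduce 1 ⟨0, hn⟩ AllowedPerm.one ?_ (isEpsNC_of_eq_zero ?_ _ _ _)
    · intro x y z _ _ _ _
      simp [hB]
    · simp [hB]

section Functional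

variable {K A : Type*}

lemma functional_congr (F : (m : ℕ) → (Fin m → I) → (Fin m → A) → K) {m m' : ℕ} (h : m = m')
    {d : Fin m → I} {d' : Fin m' → I} {a : Fin m → A} {a' : Fin m' → A}
    (hd : ∀ k, d k = d' (Fin.cast h k)) (ha : ∀ k, a k = a' (Fin.cast h k)) :
    F m d a = F m' d' a' := by
  subst h
  rw [show d = d' from funext hd, show a = a' from funext ha]

/-- Restriction to a set agrees with restriction to its image under a map that is strictly
increasing on it. -/
lemma functional_restrictFun_image (F : (m : ℕ) → (Fin m → I) → (Fin m → A) → K) {n m : ℕ}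
    {g : Fin n → Fin m} {S : Finset (Fin n)} (hg : StrictMonoOn g S) (d : Fin m → I)
    (a : Fin m → A) :
    F S.card (restrictFun (d ∘ g) S) (restrictFun (a ∘ g) S) =
      F (S.image g).card (restrictFun d (S.image g)) (restrictFun a (S.image g)) := by
  have hc : (S.image g).card = S.card := Finset.card_image_of_injOn hg.injOn
  have key : ∀ k : Fin S.card, g (S.orderEmbOfFin rfl k) =
      (S.image g).orderEmbOfFin rfl (Fin.cast hc.symm k) := by
    have h := Finset.orderEmbOfFin_unique (s := S.image g) (k := S.card) hc
      (f := fun k => g (S.orderEmbOfFin rfl k))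
      (fun k => Finset.mem_image_of_mem g (Finset.orderEmbOfFin_mem S rfl k))
      (fun k l hkl => hg (Finset.orderEmbOfFin_mem S rfl k) (Finset.orderEmbOfFin_mem S rfl l)
        ((S.orderEmbOfFin rfl).strictMono hkl))
    intro k
    rw [congrFun h k]
    exact Finset.orderEmbOfFin_eq_orderEmbOfFin_iff.2 rfl
  exact functional_congr F hc.symm (fun k => congrArg d (key k)) (fun k => congrArg a (key k))

lemma strictMonoOn_swap {n : ℕ} {i j : Fin n} (hij : (i : ℕ) + 1 = j) {S : Finset (Fin n)}
    (hS : ¬ (i ∈ S ∧ j ∈ S)) : StrictMonoOn (⇑(Equiv.swap i j)) (S : Set (Fin n)) := by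
  intro x hx y hy hxy
  rw [Finset.mem_coe] at hx hy
  rw [Equiv.swap_apply_def, Equiv.swap_apply_def]
  rw [Fin.lt_def] at hxy ⊢
  split_ifs <;> simp_all [Fin.ext_iff] <;> grind

variable [Ring A] [CommSemiring K] [Algebra K A]

/-- Invariance of a functional on decorated `m`-tuples under exchanging adjacent entries with
distinct decorations `p ≠ q` such that `ε p q = 1`. -/
def SwapInvariant (ε : I → I → Bool) (As : I → Subalgebra K A) {R : Type*}
    (F : (m : ℕ) → (Fin m → I) → (Fin m → A) → R) (m : ℕ) : Prop :=
  ∀ (d : Fin m → I) (a : Fin m → A), (∀ j, a j ∈ As (d j)) →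
    ∀ i j : Fin m, (i : ℕ) + 1 = j → d i ≠ d j → ε (d i) (d j) = true →
      F m d a = F m (d ∘ ⇑(Equiv.swap i j)) (a ∘ ⇑(Equiv.swap i j))

lemma functional_restrictFun_swap {ε : I → I → Bool} {As : I → Subalgebra K A} {R : Type*}
    {F : (m : ℕ) → (Fin m → I) → (Fin m → A) → R} {n : ℕ} {S : Finset (Fin n)}
    (hF : SwapInvariant ε As F S.card) {d : Fin n → I} {a : Fin n → A}
    (ha : ∀ j, a j ∈ As (d j)) {i j : Fin n} (hi : i ∈ S) (hj : j ∈ S)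
    (hij : (i : ℕ) + 1 = j) (hd : d i ≠ d j) (hε : ε (d i) (d j) = true) :
    F S.card (restrictFun d S) (restrictFun a S) =
      F S.card (restrictFun (d ∘ ⇑(Equiv.swap i j)) S)
        (restrictFun (a ∘ ⇑(Equiv.swap i j)) S) := by
  set e := S.orderIsoOfFin rfl
  have hei : ((e (e.symm ⟨i, hi⟩)).1 : Fin n) = i := by simp
  have hej : ((e (e.symm ⟨j, hj⟩)).1 : Fin n) = j := by simp
  have hadj : ((e.symm ⟨i, hi⟩ : Fin S.card) : ℕ) + 1 = (e.symm ⟨j, hj⟩ : Fin S.card) := by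
    have hlt : e.symm ⟨i, hi⟩ < e.symm ⟨j, hj⟩ := by
      rw [e.symm.lt_iff_lt, Subtype.mk_lt_mk, Fin.lt_def]
      omega
    by_contra hne
    rw [Fin.lt_def] at hlt
    have hjlt := (e.symm ⟨j, hj⟩).isLt
    set k : Fin S.card := ⟨(e.symm ⟨i, hi⟩ : Fin S.card) + 1, by omega⟩ with hk
    have h1 : e (e.symm ⟨i, hi⟩) < e k := by
      rw [e.lt_iff_lt, Fin.lt_def]; simp [hk]
    have h2 : e k < e (e.symm ⟨j, hj⟩) := by
      rw [e.lt_iff_lt, Fin.lt_def]; simp only [hk]; omega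
    rw [OrderIso.apply_symm_apply, ← Subtype.coe_lt_coe, Fin.lt_def] at h1 h2
    simp only at h1 h2
    omega
  have hswap : ∀ k, Equiv.swap i j (e k).1 =
      (e (Equiv.swap (e.symm ⟨i, hi⟩) (e.symm ⟨j, hj⟩) k)).1 := by
    intro k
    have hki : (e k).1 = i ↔ k = e.symm ⟨i, hi⟩ := by
      rw [OrderIso.eq_symm_apply, Subtype.ext_iff]
    have hkj : (e k).1 = j ↔ k = e.symm ⟨j, hj⟩ := by
      rw [OrderIso.eq_symm_apply, Subtype.ext_iff]
    rw [Equiv.swap_apply_def, Equiv.swap_apply_def]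
    simp only [hki, hkj]
    split_ifs <;> simp
  have h := hF (restrictFun d S) (restrictFun a S) (fun k => ha _) _ _ hadj
    (by simpa [restrictFun, e] using hd) (by simpa [restrictFun, e] using hε)
  rw [h]
  exact congrArg₂ (F S.card) (funext fun k => congrArg d (hswap k).symm)
    (funext fun k => congrArg a (hswap k).symm)

end Functional

lemma blocksSet_comap_swap {n : ℕ} (Γ : Setoid (Fin n)) (i j : Fin n) :
    blocksSet (Setoid.comap (⇑(Equiv.swap i j)) Γ) =
      (fun B => B.image (⇑(Equiv.swap i j))) '' blocksSet Γ := by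
  have hb : ∀ b, blockOf (Setoid.comap (⇑(Equiv.swap i j)) Γ) (Equiv.swap i j b) =
      (blockOf Γ b).image (⇑(Equiv.swap i j)) := by
    intro b
    ext x
    simp only [blockOf, Finset.mem_filter, Finset.mem_univ, true_and, Finset.mem_image,
      Setoid.comap_rel, Equiv.swap_apply_self]
    constructor
    · exact fun h => ⟨_, h, Equiv.swap_apply_self i j x⟩
    · rintro ⟨y, hy, rfl⟩
      simpa using hy
  ext B
  constructor
  · rintro ⟨b, rfl⟩
    refine ⟨_, ⟨Equiv.swap i j b, rfl⟩, ?_⟩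
    simp only [← hb, Equiv.swap_apply_self]
  · rintro ⟨_, ⟨b, rfl⟩, rfl⟩
    exact ⟨Equiv.swap i j b, (hb b).symm⟩

lemma image_swap_eq_self {n : ℕ} {i j : Fin n} {S : Finset (Fin n)} (hi : i ∈ S) (hj : j ∈ S) :
    S.image (⇑(Equiv.swap i j)) = S := by
  refine Finset.eq_of_subset_of_card_le (fun x hx => ?_)
    (Finset.card_image_of_injective _ (Equiv.injective _)).ge
  obtain ⟨y, hy, rfl⟩ := Finset.mem_image.1 hx
  rw [Equiv.swap_apply_def]
  split_ifs <;> assumption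

lemma cumPart_swap {K A : Type*} [Field K] [Ring A] [Algebra K A] {ε : I → I → Bool}
    {As : I → Subalgebra K A} {F : (m : ℕ) → (Fin m → I) → (Fin m → A) → K} {n : ℕ}
    {Γ : Setoid (Fin n)} (hF : ∀ B ∈ blocksSet Γ, SwapInvariant ε As F B.card)
    {d : Fin n → I} {a : Fin n → A} (ha : ∀ j, a j ∈ As (d j)) {i j : Fin n}
    (hmove : IsAllowedMove ε d Γ i j) :
    cumPart F d Γ a = cumPart F (d ∘ ⇑(Equiv.swap i j))
      (Setoid.comap (⇑(Equiv.swap i j)) Γ) (a ∘ ⇑(Equiv.swap i j)) := by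
  obtain ⟨hij, hε, hor⟩ := hmove
  unfold cumPart
  rw [blocksSet_comap_swap,
    finprod_mem_image (Finset.image_injective (Equiv.injective _)).injOn]
  refine finprod_mem_congr rfl fun B hB => ?_
  by_cases hS : i ∈ B ∧ j ∈ B
  · rw [image_swap_eq_self hS.1 hS.2]
    refine functional_restrictFun_swap (hF B hB) ha hS.1 hS.2 hij (hor.resolve_right ?_) hε
    obtain ⟨b, rfl⟩ := hB
    simp only [blockOf, Finset.mem_filter, Finset.mem_univ, true_and] at hS
    exact not_not.2 (Γ.trans (Γ.symm hS.1) hS.2)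
  · rw [← functional_restrictFun_image F (strictMonoOn_swap hij hS)]
    simp [Function.comp_assoc, ← Equiv.Perm.coe_mul]

lemma prod_ofFn_swap {M : Type*} [Monoid M] {n : ℕ} (f : Fin n → M) (i j : Fin n)
    (hij : (i : ℕ) + 1 = j) (hc : f i * f j = f j * f i) :
    (List.ofFn (f ∘ ⇑(Equiv.swap i j))).prod = (List.ofFn f).prod := by
  induction n with
  | zero => exact i.elim0
  | succ n ih =>
    cases j using Fin.cases with
    | zero => simp at hij
    | succ j =>
      cases i using Fin.cases with
      | zero =>
        cases n with
        | zero => exact j.elim0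
        | succ n =>
          obtain rfl : j = 0 := by ext; simpa using hij.symm
          have hrest : ∀ k : Fin n, Equiv.swap (0 : Fin (n + 2)) (Fin.succ 0) k.succ.succ =
              k.succ.succ := fun k =>
            Equiv.swap_apply_of_ne_of_ne (Fin.succ_ne_zero _)
              (fun h => Fin.succ_ne_zero k (Fin.succ_injective _ h))
          simp only [List.ofFn_succ, List.prod_cons, Function.comp_apply, hrest,
            Equiv.swap_apply_left, Equiv.swap_apply_right]
          rw [← mul_assoc, ← mul_assoc, hc]
      | succ i =>
        have h0 : Equiv.swap i.succ j.succ 0 = 0 :=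
          Equiv.swap_apply_of_ne_of_ne (Fin.succ_ne_zero _).symm (Fin.succ_ne_zero _).symm
        have hs : ∀ k : Fin n, Equiv.swap i.succ j.succ k.succ = (Equiv.swap i j k).succ :=
          fun k => ((Fin.succ_injective n).map_swap i j k).symm
        simp only [List.ofFn_succ, List.prod_cons, Function.comp_apply, h0, hs]
        exact congrArg _ (ih (f ∘ Fin.succ) i j (by simpa using hij) hc)

lemma swapInvariant_moment {K A : Type*} [Field K] [Ring A] [Algebra K A] {ε : I → I → Bool}
    (φ : A →ₗ[K] K) {As : I → Subalgebra K A}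
    (hcomm : ∀ i j : I, i ≠ j → ε i j = true → ∀ x ∈ As i, ∀ y ∈ As j, x * y = y * x) (m : ℕ) :
    SwapInvariant ε As (fun _ (_ : Fin _ → I) a => φ (List.ofFn a).prod) m :=
  fun _ a ha i j hij hd hε =>
    congrArg φ (prod_ofFn_swap a i j hij (hcomm _ _ hd hε _ (ha i) _ (ha j))).symm

lemma cumPart_top {K A : Type*} [Field K] {n : ℕ} (hn : 0 < n)
    (κ : (m : ℕ) → (Fin m → I) → (Fin m → A) → K) (d : Fin n → I) (a : Fin n → A) :
    cumPart κ d ⊤ a = κ n d a := by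
  have hB : blocksSet (⊤ : Setoid (Fin n)) = {Finset.univ} := by
    ext B
    simp only [blocksSet, blockOf_top, Set.mem_ofPred_eq, Set.mem_singleton_iff]
    exact ⟨fun ⟨_, h⟩ => h, fun h => ⟨⟨0, hn⟩, h⟩⟩
  rw [cumPart, hB, finprod_mem_singleton]
  have hc : (Finset.univ : Finset (Fin n)).card = n := Finset.card_fin n
  have key : ∀ k, (Finset.univ : Finset (Fin n)).orderEmbOfFin rfl k = Fin.cast hc k := fun k =>
    (congrFun (Finset.orderEmbOfFin_unique rfl (f := Fin.cast hc)
      (fun _ => Finset.mem_univ _) (fun _ _ h => h)) k).symm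
  exact functional_congr κ hc (fun k => congrArg d (key k)) (fun k => congrArg a (key k))

lemma card_lt_of_mem_blocksSet {n : ℕ} {Γ : Setoid (Fin n)} (hΓ : Γ ≠ ⊤) {B : Finset (Fin n)}
    (hB : B ∈ blocksSet Γ) : B.card < n := by
  obtain ⟨b, rfl⟩ := hB
  refine lt_of_le_of_ne (card_finset_fin_le _) fun h => hΓ ?_
  have hu : blockOf Γ b = Finset.univ := by
    rw [← Finset.card_eq_iff_eq_univ, h, Fintype.card_fin]
  have hmem : ∀ x, Γ b x := fun x => by
    have := Finset.mem_univ x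
    rw [← hu] at this
    simpa [blockOf] using this
  exact (Setoid.eq_top_iff).2 fun x y => Γ.trans (Γ.symm (hmem x)) (hmem y)

/-- ε-cumulants are invariant under exchanging adjacent entries from commuting subalgebras. -/
lemma CumulantFamily.swapInvariant {K A : Type*} [Field K] [Ring A] [Algebra K A]
    {ε : I → I → Bool} (hsym : ∀ i j : I, ε i j = ε j i) {φ : A →ₗ[K] K}
    {As : I → Subalgebra K A}
    (hcomm : ∀ i j : I, i ≠ j → ε i j = true → ∀ x ∈ As i, ∀ y ∈ As j, x * y = y * x)
    {κ : (m : ℕ) → (Fin m → I) → (Fin m → A) → K} (hκ : CumulantFamily ε φ As κ) (m : ℕ) :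
    SwapInvariant ε As κ m := by
  induction m using Nat.strong_induction_on with
  | _ m ih =>
  intro d a ha i j hij hd hε
  set τ := Equiv.swap i j with hτ
  have hmove : ∀ Γ, IsAllowedMove ε d Γ i j := fun Γ => ⟨hij, hε, Or.inl hd⟩
  have hmove' : ∀ Γ, IsAllowedMove ε (d ∘ ⇑τ) Γ i j := fun Γ =>
    ⟨hij, by simpa [hτ, hsym (d j)] using hε, Or.inl (by simpa [hτ] using hd.symm)⟩
  have hdd : (d ∘ ⇑τ) ∘ ⇑τ = d := by ext; simp [hτ]
  have split : ∀ (d : Fin m → I) (a : Fin m → A), (∀ j, a j ∈ As (d j)) →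
      φ (List.ofFn a).prod = κ m d a +
        ∑ᶠ Γ ∈ {Γ : Setoid (Fin m) | IsEpsNC ε d Γ} \ {⊤}, cumPart κ d Γ a := by
    intro d a ha
    rw [hκ m d a ha, ← cumPart_top (Fin.pos i) κ d a,
      ← finsum_mem_insert (fun Γ => cumPart κ d Γ a) (fun h => h.2 rfl) (Set.toFinite _),
      Set.insert_sdiff_singleton,
      Set.insert_eq_of_mem (show ⊤ ∈ {Γ : Setoid (Fin m) | IsEpsNC ε d Γ} from isEpsNC_top ε d)]
  have hrest : ∑ᶠ Γ ∈ {Γ : Setoid (Fin m) | IsEpsNC ε d Γ} \ {⊤}, cumPart κ d Γ a =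
      ∑ᶠ Γ ∈ {Γ : Setoid (Fin m) | IsEpsNC ε (d ∘ ⇑τ) Γ} \ {⊤},
        cumPart κ (d ∘ ⇑τ) Γ (a ∘ ⇑τ) := by
    have hinv : ∀ Γ : Setoid (Fin m), Setoid.comap τ (Setoid.comap τ Γ) = Γ := fun Γ =>
      comap_swap_comap_swap Γ i j
    have htop : Setoid.comap τ (⊤ : Setoid (Fin m)) = ⊤ := rfl
    have hne : ∀ Γ : Setoid (Fin m), Γ ≠ ⊤ → Setoid.comap τ Γ ≠ ⊤ := fun Γ hΓ h =>
      hΓ (by rw [← hinv Γ, h, htop])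
    refine finsum_mem_eq_of_bijOn (Setoid.comap τ) ⟨?_, ?_, ?_⟩ ?_
    · rintro Γ ⟨hΓ, hΓt⟩
      refine ⟨IsEpsNC.of_swap (hmove' _) ?_, hne Γ hΓt⟩
      rw [← hτ, hdd, hinv]
      exact hΓ
    · exact (Function.LeftInverse.injective hinv).injOn
    · rintro Γ ⟨hΓ, hΓt⟩
      refine ⟨Setoid.comap τ Γ, ⟨IsEpsNC.of_swap (hmove _) ?_, hne Γ hΓt⟩, hinv Γ⟩
      rw [← hτ, hinv]
      exact hΓ
    · rintro Γ ⟨_, hΓt⟩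
      exact cumPart_swap (fun B hB => ih _ (card_lt_of_mem_blocksSet hΓt hB)) ha (hmove Γ)
  have h : φ (List.ofFn a).prod = φ (List.ofFn (a ∘ ⇑τ)).prod :=
    swapInvariant_moment φ hcomm m d a ha i j hij hd hε
  rw [split d a ha, split (d ∘ ⇑τ) (a ∘ ⇑τ) (fun k => ha _), hrest] at h
  exact add_right_cancel h

/-- Lemma L1. Assume `A_i` and `A_j` commute elementwise whenever
`i ≠ j` and `ε_{ij} = 1`.  If `τ = (i, i+1)` is an allowed move for the `d`-decorated
partition `Γ` and `Γ' = τ(Γ)` (with decoration `τ(d) = d ∘ τ`), then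
`φ^Γ(a₁, …, aₙ) = φ^{Γ'}(a₁, …, a_{i+1}, a_i, …, aₙ)` and
`k_ε^Γ(a₁, …, aₙ) = k_ε^{Γ'}(a₁, …, a_{i+1}, a_i, …, aₙ)`. -/
theorem phiPart_cumPart_allowedMove {I K A : Type*} [Field K] [CharZero K]
    [Ring A] [Algebra K A]
    (ε : I → I → Bool) (hsym : ∀ i j : I, ε i j = ε j i)
    (φ : A →ₗ[K] K) (hφ1 : φ 1 = 1) (As : I → Subalgebra K A)
    (hcomm : ∀ i j : I, i ≠ j → ε i j = true →
      ∀ x ∈ As i, ∀ y ∈ As j, x * y = y * x)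
    (κ : (m : ℕ) → (Fin m → I) → (Fin m → A) → K)
    (hκ : CumulantFamily ε φ As κ)
    {n : ℕ} (d : Fin n → I) (Γ : Setoid (Fin n)) (a : Fin n → A)
    (ha : ∀ j, a j ∈ As (d j))
    (i j : Fin n) (hmove : IsAllowedMove ε d Γ i j) :
    phiPart φ Γ a =
      phiPart φ (Setoid.comap (⇑(Equiv.swap i j)) Γ) (a ∘ ⇑(Equiv.swap i j)) ∧
    cumPart κ d Γ a =
      cumPart κ (d ∘ ⇑(Equiv.swap i j)) (Setoid.comap (⇑(Equiv.swap i j)) Γ)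
        (a ∘ ⇑(Equiv.swap i j)) := by
  exact ⟨cumPart_swap (d := d) (fun B _ => swapInvariant_moment φ hcomm B.card) ha hmove,
    cumPart_swap (fun B _ => hκ.swapInvariant hsym hcomm B.card) ha hmove⟩

end EpsNC
end

section
/- Suppose the decoration d = (i_1, …, i_n) belongs to I_n^ε, and suppose τ_k = (k, k+1) is an allowed move for some d-decorated partition Γ of [n]. Then the tuple (i_1, …, i_{k−1}, i_{k+1}, i_k, i_{k+2}, …, i_n) also belongs to I_n^ε. Consequently, any allowed permutation of a d-decorated partition with d ∈ I_n^ε produces a decoration again lying in I_n^ε. -/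
/-!
Common setup: ε-noncrossing partitions (Ebrahimi-Fard–Patras–Speicher).

A partition of `[n]` is encoded as a `Setoid (Fin n)` (blocks = equivalence
classes).  A decoration is a map `d : Fin n → I`, and `ε : I → I → Bool` is a
symmetric family of values in `{0,1}` (with `true` playing the role of `1`).
-/

namespace EpsNC

open scoped Classical

variable {I : Type*}

/-- An adjacent transposition preserves every strict inequality except the one between the
two exchanged points. -/
theorem swap_lt_swap_of_adjacent {n : ℕ} {k l x y : Fin n} (hkl : (k : ℕ) + 1 = l)
    (hxy : x < y) (hne : ¬ (x = k ∧ y = l)) : Equiv.swap k l x < Equiv.swap k l y := by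
  simp only [Equiv.swap_apply_def]
  split_ifs <;> simp only [Fin.ext_iff, Fin.lt_def] at * <;> omega

theorem MemIeps.ne_of_adjacent {ε : I → I → Bool} {n : ℕ} {d : Fin n → I}
    (hd : MemIeps ε d) {k l : Fin n} (hkl : (k : ℕ) + 1 = l) : d k ≠ d l := by
  intro h
  obtain ⟨p, h1, h2, -⟩ := hd k l (Fin.lt_def.2 (by omega)) h
  simp only [Fin.lt_def] at h1 h2
  omega

theorem MemIeps.comp_swap {ε : I → I → Bool} (hsym : ∀ i j : I, ε i j = ε j i)
    {n : ℕ} {d : Fin n → I} (hd : MemIeps ε d) {k l : Fin n} (hkl : (k : ℕ) + 1 = l)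
    (hε : ε (d k) (d l) = true) : MemIeps ε (d ∘ ⇑(Equiv.swap k l)) := by
  intro a b hab heq
  simp only [Function.comp_apply] at heq ⊢
  have hlt : Equiv.swap k l a < Equiv.swap k l b := by
    refine swap_lt_swap_of_adjacent hkl hab ?_
    rintro ⟨rfl, rfl⟩
    simp only [Equiv.swap_apply_left, Equiv.swap_apply_right] at heq
    exact hd.ne_of_adjacent hkl heq.symm
  obtain ⟨p, hap, hpb, hne, hp⟩ := hd _ _ hlt heq
  refine ⟨Equiv.swap k l p, ?_, ?_, by simpa using hne, by simpa using hp⟩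
  · have := swap_lt_swap_of_adjacent hkl hap (by
      rintro ⟨h1, h2⟩
      rw [h1, h2, hsym, hε] at hp
      exact Bool.noConfusion hp)
    simpa using this
  · have := swap_lt_swap_of_adjacent hkl hpb (by
      rintro ⟨h1, h2⟩
      rw [heq, h1, h2, hε] at hp
      exact Bool.noConfusion hp)
    simpa using this

/-- Lemma L2. If the decoration `d` lies in `I_n^ε` and `τ_k` is an
allowed move for some `d`-decorated partition `Γ` of `[n]`, then the decoration
obtained by exchanging the entries `k` and `k+1` again lies in `I_n^ε`.  Consequently,
any allowed permutation `σ` of a `d`-decorated partition with `d ∈ I_n^ε` produces a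
decoration `σ(d) = d ∘ σ⁻¹` again lying in `I_n^ε`. -/
theorem memIeps_allowed {I : Type*} (ε : I → I → Bool)
    (hsym : ∀ i j : I, ε i j = ε j i)
    {n : ℕ} (d : Fin n → I) (Γ : Setoid (Fin n)) :
    (∀ k l : Fin n, MemIeps ε d → IsAllowedMove ε d Γ k l →
      MemIeps ε (d ∘ ⇑(Equiv.swap k l))) ∧
    (∀ σ : Equiv.Perm (Fin n), MemIeps ε d → AllowedPerm ε d Γ σ →
      MemIeps ε (d ∘ ⇑σ⁻¹)) := by
  refine ⟨fun k l hd h => hd.comp_swap hsym h.1 h.2.1, fun σ hd hσ => ?_⟩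
  induction hσ with
  | one => simpa using hd
  | step i j _ h ih =>
    simpa [Function.comp_assoc, permDec, Equiv.Perm.coe_mul] using
      MemIeps.comp_swap hsym ih h.1 h.2.1

end EpsNC
end
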